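/- Stability estimate from the proof of Theorem 2.2. Assume the abstract framework and transfer operators satisfying (5) and (6), and set J_h := J ∘ I_M. Then every v ∈ V and every w_h ∈ V_h satisfy |||v − J_h w_h|||_pw ≤ (1 + Λ_J)·(1 + Λ_M)·‖v − w_h‖_h. -/

import Mathlib

theorem semi_triangle {X : Type*} [AddCommGroup X] [Module ℝ X] (b : X → X → ℝ)
    (hadd : ∀ x y z : X, b (x + y) z = b x z + b y z)
    (hsmul : ∀ (c : ℝ) (x y : X), b (c • x) y = c * b x y)
    (hsymm : ∀ x y : X, b x y = b y x)
    (hnn : ∀ x : X, 0 ≤ b x x) (x y : X) :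
    Real.sqrt (b (x + y) (x + y)) ≤ Real.sqrt (b x x) + Real.sqrt (b y y) := by
  have haddr : ∀ x y z : X, b z (x + y) = b z x + b z y := fun x y z => by
    rw [hsymm, hadd, hsymm x, hsymm y]
  have hsmulr : ∀ (c : ℝ) (x y : X), b y (c • x) = c * b y x := fun c x y => by
    rw [hsymm, hsmul, hsymm x]
  have hd : discrim (b x x) (2 * b x y) (b y y) ≤ 0 := by
    apply discrim_le_zero
    intro t
    have h := hnn (t • x + y)
    rw [hadd, haddr, haddr, hsmul, hsmulr, hsmul, hsmulr, hsymm y x] at h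
    linarith
  have hcs : b x y ≤ Real.sqrt (b x x) * Real.sqrt (b y y) := by
    rw [← Real.sqrt_mul (hnn x)]
    apply Real.le_sqrt_of_sq_le
    unfold discrim at hd
    nlinarith
  apply Real.sqrt_le_iff.mpr
  refine ⟨by positivity, ?_⟩
  rw [hadd, haddr, haddr, hsymm y x]
  have h1 := Real.sq_sqrt (hnn x)
  have h2 := Real.sq_sqrt (hnn y)
  nlinarith

/-- **Stability estimate from the proof of Theorem 2.2.**
Under the abstract framework with transfer operators `IM : X → VM` and `J : VM → V`
satisfying (5) and (6) and `J_h := J ∘ IM`, every `v ∈ V` and `wh ∈ Vh` satisfy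
`|||v − J_h wh|||_pw ≤ (1 + ΛJ)(1 + ΛM) ‖v − wh‖_h`. -/
theorem stability_estimate
    {X : Type*} [AddCommGroup X] [Module ℝ X]
    (apw jh : X → X → ℝ)
    (hapw_addl : ∀ x y z : X, apw (x + y) z = apw x z + apw y z)
    (hapw_smull : ∀ (c : ℝ) (x y : X), apw (c • x) y = c * apw x y)
    (hapw_symm : ∀ x y : X, apw x y = apw y x)
    (hapw_nonneg : ∀ x : X, 0 ≤ apw x x)
    (hjh_addl : ∀ x y z : X, jh (x + y) z = jh x z + jh y z)
    (hjh_smull : ∀ (c : ℝ) (x y : X), jh (c • x) y = c * jh x y)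
    (hjh_symm : ∀ x y : X, jh x y = jh y x)
    (hjh_nonneg : ∀ x : X, 0 ≤ jh x x)
    (V VM Vh : Submodule ℝ X)
    (hjh_vanish : ∀ v ∈ V ⊔ VM, ∀ w : X, jh v w = 0)
    (npw nh : X → ℝ)
    (hnpw_def : ∀ x : X, npw x = Real.sqrt (apw x x))
    (hnh_def : ∀ x : X, nh x = Real.sqrt (apw x x + jh x x))
    (IM J : X →ₗ[ℝ] X)
    (hIM_maps : ∀ x : X, IM x ∈ VM)
    (hJ_maps : ∀ x ∈ VM, J x ∈ V)
    (ΛM ΛJ : ℝ)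
    (hΛM : 0 ≤ ΛM) (hΛJ : 0 ≤ ΛJ)
    (h5 : ∀ vh ∈ Vh, nh (vh - IM vh) ≤ ΛM * ⨅ v : V, nh ((v : X) - vh))
    (h6 : ∀ vM ∈ VM, npw (vM - J vM) ≤ ΛJ * ⨅ v : V, npw ((v : X) - vM)) :
    ∀ v ∈ V, ∀ wh ∈ Vh,
      npw (v - J (IM wh)) ≤ (1 + ΛJ) * (1 + ΛM) * nh (v - wh) := by
  intro v hv wh hwh
  have tpw : ∀ x y, npw (x + y) ≤ npw x + npw y := fun x y => by
    simp only [hnpw_def]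
    exact semi_triangle apw hapw_addl hapw_smull hapw_symm hapw_nonneg x y
  have th : ∀ x y, nh (x + y) ≤ nh x + nh y := fun x y => by
    simp only [hnh_def]
    exact semi_triangle (fun x y => apw x y + jh x y)
      (fun x y z => by simp only [hapw_addl, hjh_addl]; ring)
      (fun c x y => by simp only [hapw_smull, hjh_smull]; ring)
      (fun x y => by simp only [hapw_symm x y, hjh_symm x y])
      (fun x => add_nonneg (hapw_nonneg x) (hjh_nonneg x)) x y
  have hle : ∀ x, npw x ≤ nh x := fun x => by
    rw [hnpw_def, hnh_def]
    exact Real.sqrt_le_sqrt (by linarith [hjh_nonneg x])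
  have i5 : (⨅ v : V, nh ((v : X) - wh)) ≤ nh (v - wh) :=
    ciInf_le (f := fun v : V => nh ((v : X) - wh))
      ⟨0, by rintro _ ⟨u, rfl⟩; simp only [hnh_def]; positivity⟩ ⟨v, hv⟩
  have i6 : (⨅ u : V, npw ((u : X) - IM wh)) ≤ npw (v - IM wh) :=
    ciInf_le (f := fun u : V => npw ((u : X) - IM wh))
      ⟨0, by rintro _ ⟨u, rfl⟩; simp only [hnpw_def]; positivity⟩ ⟨v, hv⟩
  have k5 := (h5 wh hwh).trans (mul_le_mul_of_nonneg_left i5 hΛM)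
  have k6 := (h6 _ (hIM_maps wh)).trans (mul_le_mul_of_nonneg_left i6 hΛJ)
  have t1 := tpw (v - IM wh) (IM wh - J (IM wh))
  have t2 := th (v - wh) (wh - IM wh)
  rw [sub_add_sub_cancel] at t1 t2
  have k7 : npw (v - IM wh) ≤ (1 + ΛM) * nh (v - wh) := by
    linarith [hle (v - IM wh)]
  calc npw (v - J (IM wh)) ≤ (1 + ΛJ) * npw (v - IM wh) := by linarith
    _ ≤ (1 + ΛJ) * ((1 + ΛM) * nh (v - wh)) :=
      mul_le_mul_of_nonneg_left k7 (by linarith)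
    _ = _ := by ring
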